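/- arXiv:1505.00667 — 2 statements merged into one kernel-verified Lean document; each statement's English description precedes it below -/
import Mathlib

section
/- For every n ≥ 2, c_{n+1} = (2^n w_n + 2 y_n) w_n. -/
namespace Paper

/-- `s i = 2^{ν₂(i+1)}`, the largest power of 2 dividing `i+1`. -/
def s (i : ℕ) : ℕ := 2 ^ padicValNat 2 (i + 1)

/-- Continuant numerators, shifted by 2: `p 0 = p_{-2} = 0`, `p 1 = p_{-1} = 1`,
and `p (n+2) = p_n = s_n p_{n-1} + p_{n-2}`. -/
def p : ℕ → ℤ
  | 0 => 0
  | 1 => 1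
  | n + 2 => (s n : ℤ) * p (n + 1) + p n

/-- Continuant denominators, shifted by 2: `q 0 = q_{-2} = 1`, `q 1 = q_{-1} = 0`,
and `q (n+2) = q_n = s_n q_{n-1} + q_{n-2}`. -/
def q : ℕ → ℤ
  | 0 => 1
  | 1 => 0
  | n + 2 => (s n : ℤ) * q (n + 1) + q n

/-- Hurwitz–Kolden–Frame matrix of a finite sequence. -/
def M (l : List ℤ) : Matrix (Fin 2) (Fin 2) ℤ :=
  (l.map fun a => !![a, 1; 1, 0]).prod

/-- `u n = (s_1, s_2, ..., s_{2^n - 3})`. -/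
def u (n : ℕ) : List ℤ := (List.range (2 ^ n - 3)).map fun i => (s (i + 1) : ℤ)

/-- `v n = (s_1, s_2, ..., s_{2^n - 2})`. -/
def v (n : ℕ) : List ℤ := (List.range (2 ^ n - 2)).map fun i => (s (i + 1) : ℤ)

def c (n : ℕ) : ℤ := M (u n) 0 0
def e (n : ℕ) : ℤ := M (u n) 0 1
def d (n : ℕ) : ℤ := M (u n) 1 0
def f (n : ℕ) : ℤ := M (u n) 1 1
def w (n : ℕ) : ℤ := M (v n) 0 0
def y (n : ℕ) : ℤ := M (v n) 0 1
def x (n : ℕ) : ℤ := M (v n) 1 0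
def z (n : ℕ) : ℤ := M (v n) 1 1
def g (n : ℕ) : ℤ := c n + 2 * e n + f n
def r (n : ℕ) : ℤ := 2 ^ n * (w n + x n) + w n + y n + z n

end Paper

namespace Paper

theorem padicValNat_two_le_of_add_eq_two_pow {a b N : ℕ} (ha : 0 < a) (hb : 0 < b)
    (hab : a + b = 2 ^ N) : padicValNat 2 a ≤ padicValNat 2 b := by
  have hdvd : 2 ^ padicValNat 2 a ∣ a := pow_padicValNat_dvd
  have hle : padicValNat 2 a ≤ N :=
    (Nat.pow_le_pow_iff_right one_lt_two).1 ((Nat.le_of_dvd ha hdvd).trans (by omega))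
  rw [← padicValNat_dvd_iff_le hb.ne', ← Nat.dvd_add_right hdvd, hab]
  exact pow_dvd_pow 2 hle

theorem s_eq_of_add_eq {i j N : ℕ} (h : i + 1 + (j + 1) = 2 ^ N) : s i = s j := by
  have hle := padicValNat_two_le_of_add_eq_two_pow i.succ_pos j.succ_pos h
  have hge := padicValNat_two_le_of_add_eq_two_pow j.succ_pos i.succ_pos ((add_comm _ _).trans h)
  rw [s, s, hle.antisymm hge]

theorem s_eq_two_pow {i n : ℕ} (h : i + 1 = 2 ^ n) : s i = 2 ^ n := by
  rw [s, h, padicValNat.prime_pow]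

theorem u_succ_eq {n : ℕ} (hn : 1 ≤ n) :
    u (n + 1) = v n ++ (2 ^ n : ℤ) :: (v n).reverse := by
  have h2 : 2 ≤ 2 ^ n := Nat.le_self_pow (by omega) 2
  have hpow : 2 ^ (n + 1) = 2 * 2 ^ n := pow_succ' 2 n
  apply List.ext_getElem
  · simp only [u, v, List.length_append, List.length_cons, List.length_reverse, List.length_map,
      List.length_range]
    omega
  · intro i hi _
    simp only [u, List.length_map, List.length_range] at hi
    simp only [u, v, List.getElem_append, List.getElem_cons, List.getElem_reverse,
      List.getElem_map, List.getElem_range, List.length_map, List.length_range]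
    split_ifs with hlt heq
    · rfl
    · rw [s_eq_two_pow (n := n) (by omega)]
      push_cast
      rfl
    · rw [s_eq_of_add_eq (N := n + 1)]
      omega

theorem M_append (l₁ l₂ : List ℤ) : M (l₁ ++ l₂) = M l₁ * M l₂ := by
  simp [M]

theorem M_cons (a : ℤ) (l : List ℤ) : M (a :: l) = !![a, 1; 1, 0] * M l := by
  simp [M]

theorem M_reverse (l : List ℤ) : M l.reverse = (M l).transpose := by
  induction l with
  | nil => simp [M]
  | cons a l ih =>
    rw [List.reverse_cons, M_append, ih, M_cons, M_cons, Matrix.transpose_mul]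
    congr 1
    ext i j
    fin_cases i <;> fin_cases j <;> simp [M]

end Paper

open Paper Filter Real

/-- For n ≥ 2, `c_{n+1} = (2^n w_n + 2 y_n) w_n`. -/
theorem c_succ_eq (n : ℕ) (hn : 2 ≤ n) :
    c (n + 1) = (2 ^ n * w n + 2 * y n) * w n := by
  rw [c, u_succ_eq (by omega), M_append, M_cons, M_reverse, w, y]
  simp only [Matrix.mul_apply, Fin.sum_univ_two, Matrix.transpose_apply, Matrix.of_apply,
    Matrix.cons_val_zero, Matrix.cons_val_one]
  ring
end

section
/- For every n ≥ 2, |σ² − P_{n+2}/Q_{n+2}| < Q_{n+2}^{−8/3}, where P_{n+2} = g_{n+2}/(2 r_n) is a positive integer and Q_{n+2} = w_{n+1}(2^n w_n + y_n). -/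
namespace Paper

/-- The matrix of a single partial quotient. -/
def quotMat (k : ℤ) : Matrix (Fin 2) (Fin 2) ℤ := !![k, 1; 1, 0]

/-- Matrix of the prefix `(s_0, ..., s_{N-1})`. -/
def prefixMat (N : ℕ) : Matrix (Fin 2) (Fin 2) ℤ :=
  M ((List.range N).map fun i => (s i : ℤ))

lemma prefixMat_zero : prefixMat 0 = 1 := by simp [prefixMat, M]

lemma prefixMat_succ (N : ℕ) : prefixMat (N + 1) = prefixMat N * quotMat (s N) := by
  simp [prefixMat, M, List.range_succ, quotMat]

lemma prefixMat_succ' (N : ℕ) : prefixMat (N + 1) =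
    quotMat (s 0) * M ((List.range N).map fun i => (s (i + 1) : ℤ)) := by
  simp [prefixMat, M, List.range_succ_eq_map, quotMat, Function.comp_def]

lemma prefixMat_eq (N : ℕ) : prefixMat N = !![p (N + 1), p N; q (N + 1), q N] := by
  induction N with
  | zero => rw [prefixMat_zero, Matrix.one_fin_two]; simp [p, q]
  | succ N ih =>
    rw [prefixMat_succ, ih, quotMat, Matrix.mul_fin_two]
    simp [p, q, mul_comm]

lemma s_two_pow_sub_one (m : ℕ) : s (2 ^ m - 1) = 2 ^ m := by
  have : 2 ^ m - 1 + 1 = 2 ^ m := Nat.sub_add_cancel Nat.one_le_two_pow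
  simp [s, this]

lemma s_two_pow_add (m j : ℕ) (hj : j + 1 < 2 ^ m) : s (2 ^ m + j) = s j := by
  have h : padicValNat 2 (2 ^ m + (j + 1)) = padicValNat 2 (j + 1) := by
    have hlt : padicValNat 2 (j + 1) < m := by
      by_contra! hm
      have := Nat.le_of_dvd (by omega) ((pow_dvd_pow 2 hm).trans pow_padicValNat_dvd)
      omega
    apply le_antisymm
    · by_contra! hc
      have h1 : 2 ^ (padicValNat 2 (j + 1) + 1) ∣ 2 ^ m + (j + 1) :=
        (pow_dvd_pow 2 hc).trans pow_padicValNat_dvd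
      rw [Nat.dvd_add_right (pow_dvd_pow 2 hlt)] at h1
      exact pow_succ_padicValNat_not_dvd (by omega) h1
    · rw [← padicValNat_dvd_iff_le (by omega)]
      exact (Nat.dvd_add_right (pow_dvd_pow 2 hlt.le)).2 pow_padicValNat_dvd
  simp [s, ← h, add_assoc]

lemma s_zero : s 0 = 1 := by simp [s]

lemma s_two_pow_sub_two (m : ℕ) (hm : 2 ≤ m) : s (2 ^ m - 2) = 1 := by
  have h : 4 ∣ 2 ^ m := pow_dvd_pow 2 hm
  have h1 : 0 < 2 ^ m := by positivity
  rw [s, padicValNat.eq_zero_of_not_dvd (by omega), pow_zero]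

lemma prefixMat_two_pow_add (m j : ℕ) (hj : j < 2 ^ m) :
    prefixMat (2 ^ m + j) = prefixMat (2 ^ m) * prefixMat j := by
  induction j with
  | zero => simp [prefixMat_zero]
  | succ j ih =>
    rw [← add_assoc, prefixMat_succ, ih (by omega), s_two_pow_add m j hj, prefixMat_succ,
      mul_assoc]

/-- Matrix of the block `(s_0, ..., s_{2^m-2})`. -/
def blockMat (m : ℕ) : Matrix (Fin 2) (Fin 2) ℤ := prefixMat (2 ^ m - 1)

lemma blockMat_succ (m : ℕ) :
    blockMat (m + 1) = blockMat m * quotMat (2 ^ m) * blockMat m := by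
  have h : 0 < 2 ^ m := by positivity
  have h1 : 2 ^ (m + 1) - 1 = 2 ^ m + (2 ^ m - 1) := by rw [pow_succ]; omega
  have h2 : prefixMat (2 ^ m) = blockMat m * quotMat (2 ^ m) := by
    conv_lhs => rw [show 2 ^ m = 2 ^ m - 1 + 1 by omega]
    rw [prefixMat_succ, s_two_pow_sub_one]; simp [blockMat]
  rw [blockMat, h1, prefixMat_two_pow_add _ _ (by omega), h2, blockMat]

lemma blockMat_transpose (m : ℕ) : (blockMat m).transpose = blockMat m := by
  induction m with
  | zero => simp [blockMat, prefixMat_zero]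
  | succ m ih =>
    have : (quotMat (2 ^ m)).transpose = quotMat (2 ^ m) := by
      ext i j; fin_cases i <;> fin_cases j <;> simp [quotMat]
    rw [blockMat_succ, Matrix.transpose_mul, Matrix.transpose_mul, ih, this, mul_assoc]

lemma blockMat_eq_mul_v (m : ℕ) (hm : 1 ≤ m) : blockMat m = quotMat 1 * M (v m) := by
  have h : 2 ^ 1 ≤ 2 ^ m := Nat.pow_le_pow_right (by norm_num) hm
  rw [blockMat, show 2 ^ m - 1 = 2 ^ m - 2 + 1 by omega, prefixMat_succ', s_zero]
  rfl

lemma blockMat_eq_mul_u_mul (m : ℕ) (hm : 2 ≤ m) :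
    blockMat m = quotMat 1 * M (u m) * quotMat 1 := by
  have h : 2 ^ 2 ≤ 2 ^ m := Nat.pow_le_pow_right (by norm_num) hm
  rw [blockMat, show 2 ^ m - 1 = 2 ^ m - 2 + 1 by omega, prefixMat_succ,
    s_two_pow_sub_two m hm, show 2 ^ m - 2 = 2 ^ m - 3 + 1 by omega, prefixMat_succ', s_zero]
  rfl

lemma blockMat_entries (m : ℕ) (hm : 1 ≤ m) :
    blockMat m = !![w m + x m, w m; w m, y m] ∧ w m = y m + z m := by
  have h : blockMat m = !![w m + x m, y m + z m; w m, y m] := by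
    rw [blockMat_eq_mul_v m hm, Matrix.eta_fin_two (M (v m)), quotMat, Matrix.mul_fin_two]
    simp [w, x, y, z]
  have hs := congrFun (congrFun (blockMat_transpose m) 0) 1
  rw [h] at hs
  simp at hs
  exact ⟨by rw [h, ← hs], hs⟩

lemma g_eq (m : ℕ) (hm : 2 ≤ m) : g m = w m + x m := by
  have h := blockMat_eq_mul_u_mul m hm
  have he := (blockMat_entries m (by omega)).1
  rw [he, Matrix.eta_fin_two (M (u m)), quotMat, Matrix.mul_fin_two, Matrix.mul_fin_two] at h
  have h0 := congrFun (congrFun h 0) 0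
  have h1 := congrFun (congrFun h 0) 1
  have h2 := congrFun (congrFun h 1) 0
  simp at h0 h1 h2
  simp only [g, c, e, f]
  linarith

lemma r_eq (m : ℕ) (hm : 1 ≤ m) : r m = 2 ^ m * (w m + x m) + 2 * w m := by
  have := (blockMat_entries m hm).2
  rw [r]; linarith

lemma recursion (m : ℕ) (hm : 1 ≤ m) :
    w (m + 1) + x (m + 1) = (w m + x m) * (2 ^ m * (w m + x m) + 2 * w m) ∧
    w (m + 1) = 2 ^ m * (w m + x m) * w m + w m ^ 2 + y m * (w m + x m) ∧
    y (m + 1) = w m * (2 ^ m * w m + 2 * y m) := by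
  have h := blockMat_succ m
  rw [(blockMat_entries (m + 1) (by omega)).1, (blockMat_entries m hm).1, quotMat,
    Matrix.mul_fin_two, Matrix.mul_fin_two] at h
  have h0 := congrFun (congrFun h 0) 0
  have h1 := congrFun (congrFun h 1) 0
  have h2 := congrFun (congrFun h 1) 1
  simp at h0 h1 h2
  refine ⟨?_, ?_, ?_⟩ <;> linarith

lemma entries_two : w 2 = 3 ∧ x 2 = 1 ∧ y 2 = 2 := by
  have h1 : s 1 = 2 := s_two_pow_sub_one 1
  have h2 : s 2 = 1 := s_two_pow_sub_two 2 le_rfl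
  simp [w, x, y, v, M, List.range_succ, h1, h2]

/-- Determinant relation and ordering of the entries of the block matrices. -/
lemma entries_invariant (m : ℕ) (hm : 2 ≤ m) :
    (w m + x m) * y m = w m ^ 2 - 1 ∧ 0 < y m ∧ y m < w m ∧ w m < w m + x m := by
  induction m, hm using Nat.le_induction with
  | base => obtain ⟨h1, h2, h3⟩ := entries_two; simp [h1, h2, h3]
  | succ m hm ih =>
    obtain ⟨ha, hw, hy⟩ := recursion m (by omega)
    obtain ⟨i1, i2, i3, i4⟩ := ih
    rw [ha, hw, hy]
    generalize w m + x m = a at *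
    generalize w m = b at *
    generalize y m = t at *
    have hk : (1 : ℤ) ≤ 2 ^ m := one_le_pow₀ (by norm_num)
    generalize (2 : ℤ) ^ m = k at *
    have hb : 0 < b := by linarith
    have hkb : 0 < k * b := by positivity
    refine ⟨?_, by positivity, ?_, ?_⟩
    · linear_combination (b ^ 2 + 1 - t * a) * i1
    · nlinarith
    · nlinarith [mul_lt_mul_of_pos_left i4 hkb, mul_lt_mul_of_pos_left i4 hb,
        mul_lt_mul_of_pos_left i3 (hb.trans i4), mul_pos (hb.trans i4) (sub_pos.2 i4)]

lemma convergent_eq (m : ℕ) (hm : 1 ≤ m) :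
    p (2 ^ m - 2 + 2) = w m + x m ∧ q (2 ^ m - 2 + 2) = w m := by
  have h : 2 ^ 1 ≤ 2 ^ m := Nat.pow_le_pow_right (by norm_num) hm
  have h1 := prefixMat_eq (2 ^ m - 1)
  rw [← blockMat, (blockMat_entries m hm).1, show 2 ^ m - 1 + 1 = 2 ^ m - 2 + 2 by omega] at h1
  have h2 := congrFun (congrFun h1 0) 0
  have h3 := congrFun (congrFun h1 1) 0
  simp at h2 h3
  exact ⟨h2.symm, h3.symm⟩

/-- The block convergents `(w + x) / w` increase. -/
lemma convergent_le_succ (m : ℕ) (hm : 2 ≤ m) :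
    ((w m + x m : ℤ) : ℝ) / w m ≤ ((w (m + 1) + x (m + 1) : ℤ) : ℝ) / w (m + 1) := by
  obtain ⟨i1, i2, i3, i4⟩ := entries_invariant m hm
  obtain ⟨j1, j2, j3, j4⟩ := entries_invariant (m + 1) (by omega)
  obtain ⟨ha, hw, hy⟩ := recursion m (by omega)
  rw [div_le_div_iff₀ (by exact_mod_cast i2.trans i3) (by exact_mod_cast j2.trans j3)]
  norm_cast
  have : w (m + 1) = w m * (2 ^ m * (w m + x m) + 2 * w m) - 1 := by
    rw [hw]; linear_combination i1
  rw [ha, this]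
  nlinarith

/-- The penultimate block convergents `w / y` decrease. -/
lemma succ_le_convergent (m : ℕ) (hm : 2 ≤ m) :
    (w (m + 1) : ℝ) / y (m + 1) ≤ (w m : ℝ) / y m := by
  obtain ⟨i1, i2, i3, i4⟩ := entries_invariant m hm
  obtain ⟨j1, j2, j3, j4⟩ := entries_invariant (m + 1) (by omega)
  obtain ⟨ha, hw, hy⟩ := recursion m (by omega)
  rw [div_le_div_iff₀ (by exact_mod_cast j2) (by exact_mod_cast i2)]
  norm_cast
  have hk : (1 : ℤ) ≤ 2 ^ m := one_le_pow₀ (by norm_num)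
  have h : w m * y (m + 1) - w (m + 1) * y m = 2 ^ m * w m + y m := by
    rw [hw, hy]; linear_combination (-(2 ^ m * w m) - y m) * i1
  have : 0 < 2 ^ m * w m := mul_pos (by positivity) (i2.trans i3)
  linarith

lemma convergent_lt (m : ℕ) (hm : 2 ≤ m) :
    ((w m + x m : ℤ) : ℝ) / w m < (w m : ℝ) / y m := by
  obtain ⟨i1, i2, i3, i4⟩ := entries_invariant m hm
  rw [div_lt_div_iff₀ (by exact_mod_cast i2.trans i3) (by exact_mod_cast i2)]
  norm_cast
  nlinarith

lemma limit_mem_Icc (σ : ℝ)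
    (hσ : Filter.Tendsto (fun n : ℕ => (p (n + 2) : ℝ) / (q (n + 2) : ℝ)) Filter.atTop (nhds σ))
    (m : ℕ) (hm : 2 ≤ m) :
    σ ∈ Set.Icc (((w m + x m : ℤ) : ℝ) / w m) ((w m : ℝ) / y m) := by
  have hsub : Filter.Tendsto (fun k : ℕ => 2 ^ (m + k) - 2) Filter.atTop Filter.atTop := by
    apply Filter.tendsto_atTop_mono (f := fun k : ℕ => k)
    · intro k
      have h1 : m + k < 2 ^ (m + k) := Nat.lt_two_pow_self
      omega
    · exact Filter.tendsto_id
  have ht : Filter.Tendsto (fun k : ℕ => ((w (m + k) + x (m + k) : ℤ) : ℝ) / w (m + k))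
      Filter.atTop (nhds σ) := by
    refine (hσ.comp hsub).congr fun k => ?_
    obtain ⟨h1, h2⟩ := convergent_eq (m + k) (by omega)
    simp only [Function.comp_apply, h1, h2]
  have hmono : Monotone fun k : ℕ => ((w (m + k) + x (m + k) : ℤ) : ℝ) / w (m + k) :=
    monotone_nat_of_le_succ fun k => convergent_le_succ (m + k) (by omega)
  have hanti : Antitone fun k : ℕ => (w (m + k) : ℝ) / y (m + k) :=
    antitone_nat_of_succ_le fun k => succ_le_convergent (m + k) (by omega)
  have hlow := hmono.ge_of_tendsto ht 0
  have hupp := le_of_tendsto' ht fun k =>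
    (convergent_lt (m + k) (by omega)).le.trans (hanti (Nat.zero_le k))
  simp only [add_zero] at hlow hupp
  exact ⟨hlow, hupp⟩

lemma abs_sq_sub_le {a b t σ : ℝ} (ha : 0 < a) (hb : 0 < b) (ht : 0 < t)
    (h : a * t = b ^ 2 - 1) (h1 : a / b ≤ σ) (h2 : σ ≤ b / t) :
    |σ ^ 2 - a / t| ≤ 1 / t ^ 2 := by
  have hσ : 0 ≤ σ := (by positivity : 0 ≤ a / b).trans h1
  have u1 : σ ^ 2 ≤ (b / t) ^ 2 := pow_le_pow_left₀ hσ h2 2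
  have u2 : (a / b) ^ 2 ≤ σ ^ 2 := pow_le_pow_left₀ (by positivity) h1 2
  have e1 : (b / t) ^ 2 = a / t + 1 / t ^ 2 := by
    field_simp; linear_combination -h
  have e2 : a / t - 1 / t ^ 2 ≤ (a / b) ^ 2 := by
    have : (a / b) ^ 2 - (a / t - 1 / t ^ 2) = 1 / (b ^ 2 * t ^ 2) := by
      field_simp; linear_combination (a * t - 1) * h
    have : 0 ≤ 1 / (b ^ 2 * t ^ 2) := by positivity
    linarith
  rw [abs_le]; constructor <;> linarith

/-- If `0 < Q < R³` then `1 / (R Q)² < Q^{-8/3}`. -/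
lemma one_div_sq_lt_rpow {Q R : ℝ} (hQ : 0 < Q) (hR : 0 < R) (h : Q < R ^ 3) :
    1 / (R * Q) ^ 2 < Q ^ (-(8 / 3 : ℝ)) := by
  have h1 : Q ^ (2 / 3 : ℝ) < R ^ 2 := by
    have := Real.rpow_lt_rpow hQ.le h (by norm_num : (0 : ℝ) < 2 / 3)
    rwa [← Real.rpow_natCast, ← Real.rpow_mul hR.le,
      show ((3 : ℕ) : ℝ) * (2 / 3) = (2 : ℕ) by norm_num, Real.rpow_natCast] at this
  have h2 : Q ^ (8 / 3 : ℝ) = Q ^ (2 / 3 : ℝ) * Q ^ 2 := by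
    rw [show (8 / 3 : ℝ) = 2 / 3 + (2 : ℕ) by norm_num, Real.rpow_add hQ, Real.rpow_natCast]
  rw [Real.rpow_neg hQ.le, h2, ← one_div, mul_pow]
  have : 0 < Q ^ (2 / 3 : ℝ) := by positivity
  gcongr

end Paper

open Paper Filter Real

/-- For n ≥ 2, `P_{n+2} = g_{n+2}/(2 r_n)` is a positive integer and, with
`Q_{n+2} = w_{n+1}(2^n w_n + y_n)`, one has `|σ² − P_{n+2}/Q_{n+2}| < Q_{n+2}^{−8/3}`. -/
theorem sigma_sq_good_approx (σ : ℝ)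
    (hσ : Tendsto (fun n : ℕ => (p (n + 2) : ℝ) / (q (n + 2) : ℝ)) atTop (nhds σ))
    (n : ℕ) (hn : 2 ≤ n) :
    (2 * r n) ∣ g (n + 2) ∧ 0 < g (n + 2) / (2 * r n) ∧
    |σ ^ 2 - ((g (n + 2) / (2 * r n) : ℤ) : ℝ) / ((w (n + 1) * (2 ^ n * w n + y n) : ℤ) : ℝ)|
      < ((w (n + 1) * (2 ^ n * w n + y n) : ℤ) : ℝ) ^ (-(8 / 3 : ℝ)) := by
  obtain ⟨i1, i2, i3, i4⟩ := entries_invariant n hn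
  obtain ⟨j1, j2, j3, j4⟩ := entries_invariant (n + 1) (by omega)
  obtain ⟨k1, k2, k3, k4⟩ := entries_invariant (n + 2) (by omega)
  obtain ⟨ha, hw, hy⟩ := recursion n (by omega)
  obtain ⟨ha', -, hy'⟩ := recursion (n + 1) (by omega)
  obtain ⟨hσ1, hσ2⟩ := limit_mem_Icc σ hσ (n + 2) (by omega)
  have hK : (1 : ℤ) ≤ 2 ^ n := one_le_pow₀ (by norm_num)
  have hr := r_eq n (by omega)
  have hg := g_eq (n + 2) (by omega)
  have hb : 0 < w n := i2.trans i3
  have hKb : 2 ^ n * w n < 2 ^ n * (w n + x n) := mul_lt_mul_of_pos_left i4 (by linarith)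
  have hKb0 : 0 < 2 ^ n * w n := mul_pos (by linarith) hb
  have hr0 : 0 < r n := by rw [hr]; linarith
  have hS0 : 0 < 2 ^ n * w n + y n := by linarith
  have hQ0 : 0 < w (n + 1) * (2 ^ n * w n + y n) := mul_pos (j2.trans j3) hS0
  have hwr : w (n + 1) = w n * r n - 1 := by rw [hw, hr]; linear_combination i1
  have hfac : g (n + 2) =
      2 * r n * ((w n + x n) * (r n * (2 ^ n * (w n + x n) + w n) - 1)) := by
    rw [hg, ha', ha, hwr, hr]; ring
  have hyQ : y (n + 2) = 2 * r n * (w (n + 1) * (2 ^ n * w n + y n)) := by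
    have : 2 ^ n * w (n + 1) + y (n + 1) = r n * (2 ^ n * w n + y n) := by
      rw [hwr, hy, hr]; linear_combination (-(2 ^ n : ℤ)) * i1
    rw [hy']; linear_combination 2 * w (n + 1) * this
  have hQlt : w (n + 1) * (2 ^ n * w n + y n) < (2 * r n) ^ 3 := by
    have h1 : w (n + 1) < r n * r n := by
      rw [hwr]; nlinarith
    have h2 : 2 ^ n * w n + y n ≤ r n := by rw [hr]; linarith
    have h3 := mul_lt_mul h1 h2 hS0 (by positivity)
    have h4 : 0 < r n ^ 3 := by positivity
    linarith [show (2 * r n) ^ 3 = 8 * r n ^ 3 by ring, show r n * r n * r n = r n ^ 3 by ring]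
  have hdiv : g (n + 2) / (2 * r n) =
      (w n + x n) * (r n * (2 ^ n * (w n + x n) + w n) - 1) := by
    rw [hfac]; exact Int.mul_ediv_cancel_left _ (by linarith)
  have hdvd : 2 * r n ∣ g (n + 2) := ⟨_, hfac⟩
  refine ⟨hdvd, Int.ediv_pos_of_pos_of_dvd (by linarith) (by linarith) hdvd, ?_⟩
  have hquot : ((g (n + 2) / (2 * r n) : ℤ) : ℝ) / ((w (n + 1) * (2 ^ n * w n + y n) : ℤ) : ℝ)
      = ((w (n + 2) + x (n + 2) : ℤ) : ℝ) / y (n + 2) := by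
    have h2r : ((2 * r n : ℤ) : ℝ) ≠ 0 := by exact_mod_cast (by linarith : 2 * r n ≠ 0)
    rw [← hg, hyQ, hdiv, hfac, Int.cast_mul (2 * r n), Int.cast_mul (2 * r n),
      mul_div_mul_left _ _ h2r]
  rw [hquot]
  refine (abs_sq_sub_le (by exact_mod_cast (k2.trans k3).trans k4) (by exact_mod_cast k2.trans k3)
    (by exact_mod_cast k2) (by exact_mod_cast k1) hσ1 hσ2).trans_lt ?_
  rw [hyQ, Int.cast_mul (2 * r n)]
  exact one_div_sq_lt_rpow (by exact_mod_cast hQ0) (by exact_mod_cast (by linarith : 0 < 2 * r n))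
    (by exact_mod_cast hQlt)
end
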